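/- Let μ be a probability measure on Ω, let Xᵢ, Xⱼ be Boolean sensitivity indicators that are independent (μ(Xᵢ = a ∧ Xⱼ = b) = μ(Xᵢ = a)·μ(Xⱼ = b) for all a, b) with μ(Xᵢ = a) > 0 and μ(Xⱼ = b) > 0 for all a, b ∈ {0,1}, and let Mᵢ be the release indicator produced by the OSDPRR mechanism with parameter εᵢ > 0 for Xᵢ, with Mᵢ conditionally independent of Xⱼ given Xᵢ. Then observing Mᵢ = 0 leaks no information about Xⱼ: P(Xⱼ = 0 | Mᵢ = 0) / P(Xⱼ = 1 | Mᵢ = 0) = μ(Xⱼ = 0) / μ(Xⱼ = 1). -/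

import Mathlib

open MeasureTheory Real

/-- Conditional probability `P(A | B) = μ(A ∩ B) / μ(B)`, as a real number. -/
noncomputable def condProb {Ω : Type*} [MeasurableSpace Ω] (μ : Measure Ω) (A B : Set Ω) : ℝ :=
  (μ (A ∩ B)).toReal / (μ B).toReal

/-- The law of total probability over the two values of a Boolean random variable. -/
lemma measure_eq_add_inter_bool {Ω : Type*} [MeasurableSpace Ω] (μ : Measure Ω)
    {X : Ω → Bool} (hX : Measurable X) (s : Set Ω) :
    μ s = μ (s ∩ {ω | X ω = true}) + μ (s ∩ {ω | X ω = false}) := by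
  rw [← measure_inter_add_sdiff s (hX (measurableSet_singleton true))]
  congr 2
  ext ω
  simp

/-- If `X` and `Y` are independent and `M` is conditionally independent of `Y` given `X`, then
`M` and `Y` are independent. -/
lemma measure_inter_eq_mul_of_condIndep {Ω : Type*} [MeasurableSpace Ω]
    (μ : Measure Ω) [IsFiniteMeasure μ] {X Y M : Ω → Bool} (hX : Measurable X)
    (hindep : ∀ a b : Bool,
      μ {ω | X ω = a ∧ Y ω = b} = μ {ω | X ω = a} * μ {ω | Y ω = b})
    (hpos : ∀ a : Bool, 0 < μ {ω | X ω = a})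
    (hCI : ∀ m a b : Bool,
      μ {ω | M ω = m ∧ X ω = a ∧ Y ω = b} * μ {ω | X ω = a}
        = μ {ω | M ω = m ∧ X ω = a} * μ {ω | X ω = a ∧ Y ω = b}) (m b : Bool) :
    μ ({ω | Y ω = b} ∩ {ω | M ω = m}) = μ {ω | Y ω = b} * μ {ω | M ω = m} := by
  have key (a : Bool) : μ ({ω | Y ω = b} ∩ {ω | M ω = m} ∩ {ω | X ω = a})
      = μ {ω | Y ω = b} * μ ({ω | M ω = m} ∩ {ω | X ω = a}) := by
    have hset : {ω | Y ω = b} ∩ {ω | M ω = m} ∩ {ω | X ω = a}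
        = {ω | M ω = m ∧ X ω = a ∧ Y ω = b} := by
      ext ω
      simp only [Set.mem_inter_iff, Set.mem_ofPred_eq]
      tauto
    rw [hset, ← Set.ofPred_and,
      ← ENNReal.mul_left_inj (hpos a).ne' (measure_ne_top μ {ω | X ω = a}), hCI, hindep]
    ring
  rw [measure_eq_add_inter_bool μ hX, key, key, ← mul_add, ← measure_eq_add_inter_bool μ hX]

/-- **independent records leak nothing.** If the sensitivity indicators `Xᵢ` and
`Xⱼ` are independent, then observing that record `rᵢ` was not released under OSDPRR leaks no
information about `Xⱼ`: the posterior odds of `Xⱼ` given `Mᵢ = 0` equal the prior odds. -/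
theorem osdprr_independent_no_leakage {Ω : Type*} [MeasurableSpace Ω]
    (μ : Measure Ω) [IsProbabilityMeasure μ]
    (Xi Xj Mi : Ω → Bool)
    (hXi : Measurable Xi) (hXj : Measurable Xj) (hMi : Measurable Mi)
    (εi : ℝ) (hεi : 0 < εi)
    -- Xᵢ and Xⱼ are independent
    (hindep : ∀ a b : Bool,
      μ {ω | Xi ω = a ∧ Xj ω = b} = μ {ω | Xi ω = a} * μ {ω | Xj ω = b})
    (hposi : ∀ a : Bool, 0 < μ {ω | Xi ω = a})
    (hposj : ∀ b : Bool, 0 < μ {ω | Xj ω = b})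
    -- OSDPRR for Xᵢ: a sensitive record is never released
    (hrel0 : μ {ω | Mi ω = true ∧ Xi ω = false} = 0)
    -- OSDPRR for Xᵢ: a non-sensitive record is released with probability 1 - e^{-εᵢ}
    (hrel1 : (μ {ω | Mi ω = true ∧ Xi ω = true}).toReal
        = (1 - Real.exp (-εi)) * (μ {ω | Xi ω = true}).toReal)
    -- conditional independence of Mᵢ and Xⱼ given Xᵢ
    (hCI : ∀ m a b : Bool,
      μ {ω | Mi ω = m ∧ Xi ω = a ∧ Xj ω = b} * μ {ω | Xi ω = a}
        = μ {ω | Mi ω = m ∧ Xi ω = a} * μ {ω | Xi ω = a ∧ Xj ω = b}) :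
    condProb μ {ω | Xj ω = false} {ω | Mi ω = false}
        / condProb μ {ω | Xj ω = true} {ω | Mi ω = false}
      = (μ {ω | Xj ω = false}).toReal / (μ {ω | Xj ω = true}).toReal := by
  have hM : (μ {ω | Mi ω = false}).toReal ≠ 0 := by
    refine ENNReal.toReal_ne_zero.2 ⟨fun h => (hposi false).ne' ?_, measure_ne_top _ _⟩
    rw [measure_eq_add_inter_bool μ hMi, Set.inter_comm, ← Set.ofPred_and, hrel0, zero_add]
    exact measure_mono_null Set.inter_subset_right h
  have hcond (b : Bool) :
      condProb μ {ω | Xj ω = b} {ω | Mi ω = false} = (μ {ω | Xj ω = b}).toReal := by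
    rw [condProb, measure_inter_eq_mul_of_condIndep μ hXi hindep hposi hCI, ENNReal.toReal_mul,
      mul_div_cancel_right₀ _ hM]
  rw [hcond, hcond]
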